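/- Suppose X is a Banach space with a basis (e_n) such that for any two disjointly supported block subspaces Y, Z every bounded linear operator T : Y → Z is strictly singular. Then X contains no quasi-minimal subspace: every infinite-dimensional subspace of X spanned by a block sequence contains two totally incomparable infinite-dimensional subspaces. -/

import Mathlib

/-- A bounded operator between (real) normed spaces is strictly singular if it is not
bounded below on any infinite-dimensional closed subspace. -/
def StrictlySingularR {X Y : Type*}
    [NormedAddCommGroup X] [NormedSpace ℝ X]
    [NormedAddCommGroup Y] [NormedSpace ℝ Y]
    (S : X →L[ℝ] Y) : Prop :=
  ∀ Z : Submodule ℝ X, IsClosed (Z : Set X) → ¬ FiniteDimensional ℝ Z →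
    ¬ ∃ c : ℝ, 0 < c ∧ ∀ z : Z, c * ‖(z : X)‖ ≤ ‖S (z : X)‖

variable {X : Type*} [NormedAddCommGroup X] [NormedSpace ℝ X] [CompleteSpace X]

/-- The support of a vector with respect to the coordinate functionals of a basis. -/
def suppIn (coord : ℕ → X →L[ℝ] ℝ) (v : X) : Set ℕ := {n | coord n v ≠ 0}

/-- `(y_n)` is a block sequence: nonzero, finitely supported vectors with successive
supports. -/
def IsBlockSeq (coord : ℕ → X →L[ℝ] ℝ) (y : ℕ → X) : Prop :=
  (∀ n, y n ≠ 0) ∧ (∀ n, (suppIn coord (y n)).Finite) ∧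
  ∀ n m, n < m → ∀ a ∈ suppIn coord (y n), ∀ b ∈ suppIn coord (y m), a < b

/-- The closed subspace generated by a sequence. -/
def blockSpan (y : ℕ → X) : Submodule ℝ X :=
  (Submodule.span ℝ (Set.range y)).topologicalClosure

/-- Two subspaces are totally incomparable if no infinite-dimensional closed subspace of
one is isomorphic to a subspace of the other. -/
def TotallyIncomparable (U V : Submodule ℝ X) : Prop :=
  ¬ ∃ (U' V' : Submodule ℝ X), U' ≤ U ∧ V' ≤ V ∧
      IsClosed (U' : Set X) ∧ IsClosed (V' : Set X) ∧
      ¬ FiniteDimensional ℝ U' ∧ ¬ FiniteDimensional ℝ V' ∧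
      Nonempty (↥U' ≃L[ℝ] ↥V')

section Helpers

/-- Partial sum projections. -/
noncomputable def psum (e : ℕ → X) (coord : ℕ → X →L[ℝ] ℝ) (N : ℕ) : X →L[ℝ] X :=
  ∑ n ∈ Finset.range N, (coord n).smulRight (e n)

theorem psum_apply (e : ℕ → X) (coord : ℕ → X →L[ℝ] ℝ) (N : ℕ) (x : X) :
    psum e coord N x = ∑ n ∈ Finset.range N, coord n x • e n := by
  simp [psum]

theorem coord_psum (e : ℕ → X) (coord : ℕ → X →L[ℝ] ℝ)
    (hbi : ∀ n m, coord n (e m) = if n = m then 1 else 0) (N k : ℕ) (x : X) :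
    coord k (psum e coord N x) = if k < N then coord k x else 0 := by
  simp [psum_apply, map_sum, hbi]

theorem psum_congr (e : ℕ → X) (coord : ℕ → X →L[ℝ] ℝ) (N : ℕ) (x y : X)
    (h : ∀ k < N, coord k x = coord k y) : psum e coord N x = psum e coord N y := by
  rw [psum_apply, psum_apply]
  refine Finset.sum_congr rfl fun k hk => ?_
  rw [h k (Finset.mem_range.1 hk)]

theorem psum_bound (e : ℕ → X) (coord : ℕ → X →L[ℝ] ℝ)
    (hexp : ∀ x : X, Filter.Tendsto
      (fun N => ∑ n ∈ Finset.range N, coord n x • e n) Filter.atTop (nhds x)) :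
    ∃ K : ℝ, 1 ≤ K ∧ ∀ N, ‖psum e coord N‖ ≤ K := by
  obtain ⟨C, hC⟩ := banach_steinhaus (g := fun N => psum e coord N) (by
    intro x
    obtain ⟨C, hC⟩ := (hexp x).norm.bddAbove_range
    refine ⟨C, fun N => ?_⟩
    rw [psum_apply]
    exact hC ⟨N, rfl⟩)
  exact ⟨max 1 C, le_max_left _ _, fun N => (hC N).trans (le_max_right _ _)⟩

theorem eq_zero_of_coord (e : ℕ → X) (coord : ℕ → X →L[ℝ] ℝ)
    (hexp : ∀ x : X, Filter.Tendsto
      (fun N => ∑ n ∈ Finset.range N, coord n x • e n) Filter.atTop (nhds x))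
    (x : X) (h : ∀ n, coord n x = 0) : x = 0 := by
  have := hexp x
  simp only [h, zero_smul, Finset.sum_const_zero] at this
  exact tendsto_nhds_unique this tendsto_const_nhds

theorem blockSpan_infinite (e : ℕ → X) (coord : ℕ → X →L[ℝ] ℝ)
    (hexp : ∀ x : X, Filter.Tendsto
      (fun N => ∑ n ∈ Finset.range N, coord n x • e n) Filter.atTop (nhds x))
    (y : ℕ → X) (hy : IsBlockSeq coord y) : ¬ FiniteDimensional ℝ (blockSpan y) := by
  obtain ⟨h0, -, hlt⟩ := hy
  have hex : ∀ n, ∃ a, coord a (y n) ≠ 0 := by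
    intro n
    by_contra! h
    exact h0 n (eq_zero_of_coord e coord hexp _ h)
  choose a ha using hex
  have hz : ∀ n m, n ≠ m → coord (a n) (y m) = 0 := by
    intro n m hnm
    by_contra h
    rcases lt_or_gt_of_ne hnm with h' | h'
    · exact lt_irrefl _ (hlt n m h' (a n) (ha n) (a n) h)
    · exact lt_irrefl _ (hlt m n h' (a n) h (a n) (ha n))
  have hli : LinearIndependent ℝ y := by
    rw [linearIndependent_iff']
    intro s g hg i hi
    have := congrArg (coord (a i)) hg
    rw [map_sum, Finset.sum_eq_single i] at this
    · simpa [ha i] using this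
    · intro b _ hb
      simp [hz i b (Ne.symm hb)]
    · intro h; exact absurd hi h
  intro hfd
  have hmem : ∀ n, y n ∈ blockSpan y := fun n =>
    Submodule.le_topologicalClosure _ (Submodule.subset_span ⟨n, rfl⟩)
  have hli' : LinearIndependent ℝ (fun n => (⟨y n, hmem n⟩ : blockSpan y)) :=
    LinearIndependent.of_comp (blockSpan y).subtype hli
  exact (Set.infinite_univ (α := ℕ)) (Set.finite_univ_iff.2 hli'.finite)

theorem exists_vec (e : ℕ → X) (coord : ℕ → X →L[ℝ] ℝ)
    (hexp : ∀ x : X, Filter.Tendsto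
      (fun N => ∑ n ∈ Finset.range N, coord n x • e n) Filter.atTop (nhds x))
    (U : Submodule ℝ X) (hU : ¬ FiniteDimensional ℝ U) (N : ℕ) (ε : ℝ) (hε : 0 < ε) :
    ∃ (x : X) (M : ℕ), x ∈ U ∧ ‖x‖ = 1 ∧ (∀ n < N, coord n x = 0) ∧ N ≤ M ∧
      ‖x - psum e coord M x‖ < ε := by
  let L : U →ₗ[ℝ] (Fin N → ℝ) := LinearMap.pi fun i => (coord i).toLinearMap ∘ₗ U.subtype
  have hL : ¬ Function.Injective L := fun h => hU (FiniteDimensional.of_injective L h)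
  rw [← LinearMap.ker_eq_bot, Submodule.eq_bot_iff] at hL
  push Not at hL
  obtain ⟨z, hz, hz0⟩ := hL
  have hzX : (z : X) ≠ 0 := by simpa using hz0
  have hc : ∀ n < N, coord n (z : X) = 0 := by
    intro n hn
    exact congrFun (LinearMap.mem_ker.1 hz) ⟨n, hn⟩
  set x : X := ‖(z : X)‖⁻¹ • (z : X) with hx
  have h1 := (hexp x)
  rw [Metric.tendsto_atTop] at h1
  obtain ⟨M, hM⟩ := h1 ε hε
  refine ⟨x, max M N, U.smul_mem _ z.2, ?_, ?_, le_max_right _ _, ?_⟩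
  · rw [hx, norm_smul, norm_inv, norm_norm, inv_mul_cancel₀ (norm_ne_zero_iff.2 hzX)]
  · intro n hn
    simp [hx, hc n hn]
  · have := hM (max M N) (le_max_left _ _)
    rwa [psum_apply, ← dist_eq_norm, dist_comm]

theorem key (e : ℕ → X) (coord : ℕ → X →L[ℝ] ℝ)
    (hbi : ∀ n m, coord n (e m) = if n = m then 1 else 0)
    (hexp : ∀ x : X, Filter.Tendsto
      (fun N => ∑ n ∈ Finset.range N, coord n x • e n) Filter.atTop (nhds x))
    (U : Submodule ℝ X) (hUc : IsClosed (U : Set X)) (hU : ¬ FiniteDimensional ℝ U) :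
    ∃ (u : ℕ → X) (A : X →L[ℝ] X), IsBlockSeq coord u ∧
      (∀ n, ∃ x ∈ U, suppIn coord (u n) ⊆ suppIn coord x) ∧
      (∀ z ∈ blockSpan u, A z ∈ U) ∧ ∀ z, (1 / 2) * ‖z‖ ≤ ‖A z‖ := by
  obtain ⟨K, hK1, hK⟩ := psum_bound e coord hexp
  have hK0 : 0 < K := by linarith
  set ε : ℕ → ℝ := fun n => (1 / (16 * K)) * (1 / 2) ^ n with hεdef
  have hε : ∀ n, 0 < ε n := fun n => by positivity
  have hε2 : ∀ n, ε n ≤ 1 / 2 := by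
    intro n
    have h1 : (1 / (16 * K)) ≤ 1 / 2 := by
      apply one_div_le_one_div_of_le <;> linarith
    have h2 : ((1 : ℝ) / 2) ^ n ≤ 1 := pow_le_one₀ (by norm_num) (by norm_num)
    calc ε n ≤ (1 / (16 * K)) * 1 := by
          apply mul_le_mul_of_nonneg_left h2; positivity
      _ ≤ 1 / 2 := by linarith
  choose x' M' hxU hx1 hx0 hNM hxε using fun (N n : ℕ) =>
    exists_vec e coord hexp U hU N (ε n) (hε n)
  let b : ℕ → ℕ := fun n => Nat.rec 0 (fun n N => M' N n) n
  have hbs : ∀ n, b (n + 1) = M' (b n) n := fun n => rfl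
  have hbmono : Monotone b := monotone_nat_of_le_succ fun n => hNM _ _
  let x : ℕ → X := fun n => x' (b n) n
  let u : ℕ → X := fun n => psum e coord (b (n + 1)) (x n)
  have hux : ∀ n, ‖x n - u n‖ < ε n := fun n => hxε (b n) n
  have hcu : ∀ n k, coord k (u n) = if k < b (n + 1) then coord k (x n) else 0 :=
    fun n k => coord_psum e coord hbi _ _ _
  have hsupp : ∀ n, ∀ k ∈ suppIn coord (u n), b n ≤ k ∧ k < b (n + 1) ∧ coord k (x n) ≠ 0 := by
    intro n k hk
    have hk' : coord k (u n) ≠ 0 := hk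
    rw [hcu] at hk'
    split_ifs at hk' with h
    · refine ⟨?_, h, hk'⟩
      by_contra! h'
      exact hk' (hx0 (b n) n k h')
    · exact absurd rfl hk'
  have hun : ∀ n, 1 / 2 ≤ ‖u n‖ := by
    intro n
    have h1 : ‖x n‖ = 1 := hx1 _ _
    have h2 : ‖x n‖ - ‖u n‖ ≤ ‖x n - u n‖ := norm_sub_norm_le _ _
    have := hux n
    have := hε2 n
    linarith
  have hu0 : ∀ n, u n ≠ 0 := by
    intro n h
    have := hun n
    rw [h, norm_zero] at this
    linarith
  have hblock : IsBlockSeq coord u := by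
    refine ⟨hu0, fun n => ?_, ?_⟩
    · exact (Set.finite_Iio (b (n + 1))).subset fun k hk => (hsupp n k hk).2.1
    · intro n m hnm p hp q hq
      exact (hsupp n p hp).2.1.trans_le ((hbmono hnm).trans (hsupp m q hq).1)
  -- projections acting on blocks
  have hpu : ∀ m N, b (m + 1) ≤ N → psum e coord N (u m) = u m := by
    intro m N hN
    refine sub_eq_zero.1 (eq_zero_of_coord e coord hexp _ fun k => ?_)
    rw [map_sub, coord_psum e coord hbi]
    split_ifs with h
    · simp
    · rw [hcu, if_neg (by omega)]; simp
  have hpu0 : ∀ m N, N ≤ b m → psum e coord N (u m) = 0 := by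
    intro m N hN
    rw [← map_zero (psum e coord N)]
    refine psum_congr e coord N _ _ fun k hk => ?_
    rw [map_zero]
    by_contra h
    have := (hsupp m k h).1
    omega
  choose g hg1 hg2 using fun n => exists_dual_vector ℝ (u n) (norm_ne_zero_iff.2 (hu0 n))
  let f : ℕ → X →L[ℝ] ℝ := fun n =>
    (‖u n‖⁻¹ • g n).comp (psum e coord (b (n + 1)) - psum e coord (b n))
  have hfn : ∀ n, ‖f n‖ ≤ 4 * K := by
    intro n
    have h1 : ‖‖u n‖⁻¹ • g n‖ ≤ 2 := by
      rw [norm_smul, hg1, norm_inv, norm_norm, mul_one]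
      calc ‖u n‖⁻¹ ≤ (1 / 2 : ℝ)⁻¹ := inv_anti₀ (by norm_num) (hun n)
        _ = 2 := by norm_num
    have h2 : ‖psum e coord (b (n + 1)) - psum e coord (b n)‖ ≤ 2 * K := by
      refine (norm_sub_le _ _).trans ?_
      have := hK (b (n + 1))
      have := hK (b n)
      linarith
    calc ‖f n‖ ≤ _ := ContinuousLinearMap.opNorm_comp_le _ _
      _ ≤ 2 * (2 * K) := mul_le_mul h1 h2 (norm_nonneg _) (by norm_num)
      _ = 4 * K := by ring
  have hfu : ∀ n m, f n (u m) = if n = m then 1 else 0 := by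
    intro n m
    change (‖u n‖⁻¹ • g n) (psum e coord (b (n + 1)) (u m) - psum e coord (b n) (u m)) = _
    rcases lt_trichotomy n m with h | h | h
    · rw [hpu0 m _ (hbmono h), hpu0 m _ (hbmono h.le), if_neg h.ne]; simp
    · subst h
      rw [hpu n _ le_rfl, hpu0 n _ le_rfl, if_pos rfl, sub_zero]
      simp [hg2, hu0 n]
    · rw [hpu m (b (n + 1)) (hbmono (show m + 1 ≤ n + 1 by omega)), hpu m (b n) (hbmono h), if_neg h.ne']; simp
  let D : ℕ → X →L[ℝ] X := fun n => (f n).smulRight (x n - u n)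
  have hD : ∀ n, ‖D n‖ ≤ (1 / 4) * (1 / 2) ^ n := by
    intro n
    have : ‖D n‖ = ‖f n‖ * ‖x n - u n‖ := ContinuousLinearMap.norm_smulRight_apply _ _
    rw [this]
    calc _ ≤ (4 * K) * ε n := mul_le_mul (hfn n) (hux n).le (norm_nonneg _) (by positivity)
      _ = _ := by simp only [hεdef]; field_simp; norm_num
  have hgeo : HasSum (fun n : ℕ => (1 / 4 : ℝ) * (1 / 2) ^ n) (1 / 2) := by
    have := hasSum_geometric_two.mul_left (1 / 4 : ℝ)
    norm_num at this ⊢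
    exact this
  have hDs : Summable D := Summable.of_norm_bounded hgeo.summable hD
  have hDn : ‖∑' n, D n‖ ≤ 1 / 2 := tsum_of_norm_bounded hgeo hD
  let A : X →L[ℝ] X := ContinuousLinearMap.id ℝ X + ∑' n, D n
  have hAu : ∀ m, A (u m) = x m := by
    intro m
    have h1 : HasSum (fun n => D n (u m)) ((∑' n, D n) (u m)) :=
      hDs.hasSum.mapL (ContinuousLinearMap.apply ℝ X (u m))
    have h2 : HasSum (fun n => D n (u m)) (x m - u m) := by
      have : (fun n => D n (u m)) = fun n => if n = m then x m - u m else 0 := by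
        funext n
        change f n (u m) • (x n - u n) = _
        rw [hfu]
        split_ifs with h
        · rw [h, one_smul]
        · rw [zero_smul]
      rw [this]
      exact hasSum_ite_eq m _
    change u m + (∑' n, D n) (u m) = x m
    rw [h1.unique h2]
    abel
  refine ⟨u, A, hblock, fun n => ⟨x n, hxU _ _, fun k hk => (hsupp n k hk).2.2⟩, ?_, ?_⟩
  · have hle : blockSpan u ≤ U.comap A.toLinearMap := by
      refine Submodule.topologicalClosure_minimal _ ?_ (hUc.preimage A.continuous)
      rw [Submodule.span_le]
      rintro _ ⟨n, rfl⟩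
      change A (u n) ∈ U
      rw [hAu]
      exact hxU _ _
    exact fun z hz => hle hz
  · intro z
    have h1 : ‖(∑' n, D n) z‖ ≤ 1 / 2 * ‖z‖ := ContinuousLinearMap.le_of_opNorm_le _ hDn z
    have h2 : ‖z‖ - ‖(∑' n, D n) z‖ ≤ ‖z + (∑' n, D n) z‖ := by
      have := norm_sub_norm_le z (-(∑' n, D n) z)
      rwa [norm_neg, sub_neg_eq_add] at this
    change _ ≤ ‖z + (∑' n, D n) z‖
    linarith

end Helpers

/-- Suppose `X` is a Banach space with a basis `(e_n)` (with coordinate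
functionals `coord`) such that for any two disjointly supported block subspaces `Y, Z`
every bounded operator `T : Y → Z` is strictly singular.  Then `X` contains no
quasi-minimal subspace: every infinite-dimensional subspace of `X` spanned by a block
sequence contains two totally incomparable infinite-dimensional closed subspaces. -/
theorem no_quasi_minimal_subspace
    (e : ℕ → X) (coord : ℕ → X →L[ℝ] ℝ)
    (hbi : ∀ n m, coord n (e m) = if n = m then 1 else 0)
    (hexp : ∀ x : X, Filter.Tendsto
      (fun N => ∑ n ∈ Finset.range N, coord n x • e n) Filter.atTop (nhds x))
    (hss : ∀ u v : ℕ → X, IsBlockSeq coord u → IsBlockSeq coord v →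
      (∀ n m, Disjoint (suppIn coord (u n)) (suppIn coord (v m))) →
      ∀ T : ↥(blockSpan u) →L[ℝ] ↥(blockSpan v), StrictlySingularR T) :
    ∀ y : ℕ → X, IsBlockSeq coord y →
      ∃ U V : Submodule ℝ X, U ≤ blockSpan y ∧ V ≤ blockSpan y ∧
        IsClosed (U : Set X) ∧ IsClosed (V : Set X) ∧
        ¬ FiniteDimensional ℝ U ∧ ¬ FiniteDimensional ℝ V ∧
        TotallyIncomparable U V := by
  intro y hy
  obtain ⟨hy0, hyf, hylt⟩ := hy
  have hsub : ∀ φ : ℕ → ℕ, StrictMono φ → IsBlockSeq coord (fun n => y (φ n)) := fun φ hφ =>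
    ⟨fun n => hy0 _, fun n => hyf _, fun n m h => hylt _ _ (hφ h)⟩
  have hle : ∀ φ : ℕ → ℕ, blockSpan (fun n => y (φ n)) ≤ blockSpan y := fun φ =>
    Submodule.topologicalClosure_mono (Submodule.span_mono (by
      rintro _ ⟨n, rfl⟩; exact ⟨φ n, rfl⟩))
  have hw := hsub (fun n => 2 * n) (fun a b h => by dsimp only; omega)
  have hv := hsub (fun n => 2 * n + 1) (fun a b h => by dsimp only; omega)
  refine ⟨blockSpan (fun n => y (2 * n)), blockSpan (fun n => y (2 * n + 1)),
    hle _, hle _, Submodule.isClosed_topologicalClosure _, Submodule.isClosed_topologicalClosure _,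
    blockSpan_infinite e coord hexp _ hw, blockSpan_infinite e coord hexp _ hv, ?_⟩
  rintro ⟨U', V', hU', hV', hUc, -, hUi, -, ⟨Φ⟩⟩
  obtain ⟨u, A, hu, hus, hAU, hA⟩ := key e coord hbi hexp U' hUc hUi
  have hdisj : ∀ n m, Disjoint (suppIn coord (u n)) (suppIn coord (y (2 * m + 1))) := by
    intro n m
    obtain ⟨x, hx, hxs⟩ := hus n
    rw [Set.disjoint_left]
    intro k hk hk'
    have hle : blockSpan (fun n => y (2 * n)) ≤ LinearMap.ker (coord k).toLinearMap := by
      refine Submodule.topologicalClosure_minimal _ ?_ (coord k).isClosed_ker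
      rw [Submodule.span_le]
      rintro _ ⟨j, rfl⟩
      change coord k (y (2 * j)) = 0
      by_contra h
      rcases lt_or_gt_of_ne (show 2 * j ≠ 2 * m + 1 by omega) with h' | h'
      · exact lt_irrefl _ (hylt _ _ h' k h k hk')
      · exact lt_irrefl _ (hylt _ _ h' k hk' k h)
    exact hxs hk (hle (hU' hx))
  let B : blockSpan u →L[ℝ] U' :=
    (A.comp (blockSpan u).subtypeL).codRestrict U' (fun z => hAU z z.2)
  let ι : V' →L[ℝ] blockSpan (fun n => y (2 * n + 1)) :=
    V'.subtypeL.codRestrict _ (fun z => hV' z.2)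
  let T := ι.comp ((Φ : U' →L[ℝ] V').comp B)
  have hinf := blockSpan_infinite e coord hexp u hu
  refine hss u (fun n => y (2 * n + 1)) hu hv hdisj T ⊤ isClosed_univ ?_ ?_
  · intro h
    exact hinf (LinearEquiv.finiteDimensional (Submodule.topEquiv (R := ℝ) (M := blockSpan u)))
  · set C : ℝ := ‖(Φ.symm : V' →L[ℝ] U')‖ + 1 with hC
    have hC0 : 0 < C := by positivity
    refine ⟨(1 / 2) / C, by positivity, ?_⟩
    intro z
    have h1 : ‖T (z : blockSpan u)‖ = ‖Φ (B z)‖ := rfl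
    have h2 : ‖B z‖ = ‖A ((z : blockSpan u) : X)‖ := rfl
    have h3 : ‖B z‖ ≤ C * ‖Φ (B z)‖ := by
      have := (Φ.symm : V' →L[ℝ] U').le_opNorm (Φ (B z))
      simp only [ContinuousLinearEquiv.coe_coe, ContinuousLinearEquiv.symm_apply_apply] at this
      refine this.trans (mul_le_mul_of_nonneg_right ?_ (norm_nonneg _))
      linarith
    have h4 := hA ((z : blockSpan u) : X)
    rw [h1, div_mul_eq_mul_div, div_le_iff₀ hC0]
    have h5 : ‖(z : blockSpan u)‖ = ‖((z : blockSpan u) : X)‖ := rfl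
    rw [h5]
    linarith
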